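/- arXiv:math/0703453 — 2 statements merged into one kernel-verified Lean document; each statement's English description precedes it below -/
import Mathlib

section
/- For all x ∈ V and all A ∈ DIR, the function t ↦ INF(x,A,t), regarded as a function on the positive integers t with t ≡ x₁ (mod 2), is bimodal. -/
open Finset

/-- Vertices: we work on `ℤ × ℤ`; the grid `V` consists of points with
`x₁ ≡ x₂ (mod 2)`. -/
abbrev Vtx : Type := ℤ × ℤ

/-- The four diagonal directions. -/
def DIRset : Finset Vtx := {(1,1), (1,-1), (-1,-1), (-1,1)}

/-- Membership in `V`: both coordinates have the same parity. -/
def inV (x : Vtx) : Prop := x.1 % 2 = x.2 % 2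

/-- `H x t`: probability that a random-walk chip starting at `x` is at the
origin after `t` steps. -/
noncomputable def H (x : Vtx) (t : ℕ) : ℝ :=
  if x.1 % 2 = (t : ℤ) % 2 ∧ x.2 % 2 = (t : ℤ) % 2 ∧ |x.1| ≤ (t : ℤ) ∧ |x.2| ≤ (t : ℤ) then
    (4 : ℝ) ^ (-(t : ℤ)) * (Nat.choose t (((t : ℤ) + x.1) / 2).toNat)
      * (Nat.choose t (((t : ℤ) + x.2) / 2).toNat)
  else 0

/-- `INF x A t := H (x+A) (t-1) - H x t`, for `t ≥ 1`. -/
noncomputable def INF (x A : Vtx) (t : ℕ) : ℝ := H (x + A) (t - 1) - H x t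

/-- A function is monotone-or-antitone on a set. -/
def MonoOrAntiOn (g : ℕ → ℝ) (S : Set ℕ) : Prop := MonotoneOn g S ∨ AntitoneOn g S

/-- Unimodal on `X`: monotone up to some `t₁ ∈ X` and monotone from `t₁` on. -/
def UnimodalOn (g : ℕ → ℝ) (X : Set ℕ) : Prop :=
  ∃ t₁ ∈ X, MonoOrAntiOn g (X ∩ Set.Iic t₁) ∧ MonoOrAntiOn g (X ∩ Set.Ici t₁)

/-- Bimodal on `X`: monotone on `{≤ t₁}`, `[t₁,t₂]` and `{≥ t₂}` for some
`t₁ ≤ t₂` in `X`. -/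
def BimodalOn (g : ℕ → ℝ) (X : Set ℕ) : Prop :=
  ∃ t₁ ∈ X, ∃ t₂ ∈ X, t₁ ≤ t₂ ∧ MonoOrAntiOn g (X ∩ Set.Iic t₁) ∧
    MonoOrAntiOn g (X ∩ Set.Icc t₁ t₂) ∧ MonoOrAntiOn g (X ∩ Set.Ici t₂)

/-- Strictly bimodal: bimodal but not unimodal. -/
def StrictlyBimodalOn (g : ℕ → ℝ) (X : Set ℕ) : Prop :=
  BimodalOn g X ∧ ¬ UnimodalOn g X

/-- The domain of times considered at a vertex `x`: positive integers `t`
with `t ≡ x₁ (mod 2)`. -/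
def Xdom (x : Vtx) : Set ℕ := {t : ℕ | 1 ≤ t ∧ (t : ℤ) % 2 = x.1 % 2}


namespace InfB

/-- quartic with coefficients `c` -/
def F (c : ℕ → ℤ) (τ : ℤ) : ℤ := ∑ i ∈ Finset.range 5, c i * τ ^ i

def Up (c : ℕ → ℤ) : Prop :=
  ∃ k < 6, ∀ i < 5, (i < k → c i ≤ 0) ∧ (k ≤ i → 0 ≤ c i)

def Down (c : ℕ → ℤ) : Prop :=
  ∃ k < 6, ∀ i < 5, (i < k → 0 ≤ c i) ∧ (k ≤ i → c i ≤ 0)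

def Two (c : ℕ → ℤ) : Prop :=
  c 0 ≤ 0 ∧ c 4 ≤ 0 ∧ (0 ≤ c 2 ∨ c 3 ≤ 0 ∨ c 1 ≤ 0)

def Good (c : ℕ → ℤ) : Prop := Up c ∨ Down c ∨ Two c

lemma pw {x y : ℤ} (hx : 0 ≤ x) (hxy : x ≤ y) {i k : ℕ} (h : i ≤ k) :
    y ^ i * x ^ k ≤ x ^ i * y ^ k := by
  obtain ⟨d, rfl⟩ := Nat.exists_eq_add_of_le h
  have h1 : x ^ d ≤ y ^ d := pow_le_pow_left₀ hx hxy d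
  have h2 : 0 ≤ x ^ i * y ^ i := by
    have := hx.trans hxy
    positivity
  calc y ^ i * x ^ (i + d) = (x ^ i * y ^ i) * x ^ d := by ring
    _ ≤ (x ^ i * y ^ i) * y ^ d := mul_le_mul_of_nonneg_left h1 h2
    _ = _ := by ring

lemma up_ok {c : ℕ → ℤ} (h : Up c) {x y : ℤ} (hx : 0 ≤ x) (hxy : x < y)
    (hf : 0 < F c x) : 0 ≤ F c y := by
  obtain ⟨k, -, hk⟩ := h
  have key : F c x * y ^ k ≤ F c y * x ^ k := by
    unfold F
    rw [Finset.sum_mul, Finset.sum_mul]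
    apply Finset.sum_le_sum
    intro i hi
    obtain ⟨h1, h2⟩ := hk i (Finset.mem_range.1 hi)
    rcases lt_or_ge i k with h | h
    · have := mul_le_mul_of_nonpos_left (pw hx hxy.le h.le) (h1 h)
      calc _ = c i * (x ^ i * y ^ k) := by ring
        _ ≤ c i * (y ^ i * x ^ k) := this
        _ = _ := by ring
    · have := mul_le_mul_of_nonneg_left (pw hx hxy.le h) (h2 h)
      calc _ = c i * (y ^ k * x ^ i) := by ring
        _ ≤ c i * (x ^ k * y ^ i) := this
        _ = _ := by ring
  by_contra hneg
  push Not at hneg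
  have h1 : 0 < F c x * y ^ k := mul_pos hf (pow_pos (by omega) k)
  have h2 : F c y * x ^ k ≤ 0 := mul_nonpos_of_nonpos_of_nonneg hneg.le (pow_nonneg hx k)
  omega

lemma down_ok {c : ℕ → ℤ} (h : Down c) {y z : ℤ} (hy : 0 ≤ y) (hyz : y < z)
    (hf : 0 < F c z) : 0 ≤ F c y := by
  obtain ⟨k, -, hk⟩ := h
  have key : F c z * y ^ k ≤ F c y * z ^ k := by
    unfold F
    rw [Finset.sum_mul, Finset.sum_mul]
    apply Finset.sum_le_sum
    intro i hi
    obtain ⟨h1, h2⟩ := hk i (Finset.mem_range.1 hi)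
    rcases lt_or_ge i k with h | h
    · have := mul_le_mul_of_nonneg_left (pw hy hyz.le h.le) (h1 h)
      calc _ = c i * (z ^ i * y ^ k) := by ring
        _ ≤ c i * (y ^ i * z ^ k) := this
        _ = _ := by ring
    · have := mul_le_mul_of_nonpos_left (pw hy hyz.le h) (h2 h)
      calc _ = c i * (y ^ k * z ^ i) := by ring
        _ ≤ c i * (z ^ k * y ^ i) := this
        _ = _ := by ring
  by_contra hneg
  push Not at hneg
  have h1 : 0 ≤ F c z * y ^ k := mul_nonneg hf.le (pow_nonneg hy k)
  have h2 : F c y * z ^ k < 0 := mul_neg_of_neg_of_pos hneg (pow_pos (by omega) k)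
  omega

lemma F_eq (c : ℕ → ℤ) (τ : ℤ) :
    F c τ = c 0 + c 1 * τ + c 2 * τ ^ 2 + c 3 * τ ^ 3 + c 4 * τ ^ 4 := by
  simp [F, Finset.sum_range_succ]

lemma two_ok {c : ℕ → ℤ} (h : Two c) {x y z : ℤ} (hx : 0 ≤ x) (hxy : x < y) (hyz : y < z)
    (hfx : 0 < F c x) (hfz : 0 < F c z) : 0 ≤ F c y := by
  obtain ⟨h0, h4, h⟩ := h
  have hx0 : 0 < x := by
    rcases hx.lt_or_eq with h | h
    · exact h
    · subst h; rw [F_eq] at hfx; simp at hfx; omega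
  have hy0 : 0 < y := by omega
  have hz0 : 0 < z := by omega
  have d1 : 0 < y - x := by omega
  have d2 : 0 < z - y := by omega
  have d3 : 0 < z - x := by omega
  have n0 : 0 ≤ - c 0 := by omega
  have n4 : 0 ≤ - c 4 := by omega
  rcases h with h | h | h
  · have e : (x*z*(z^2-x^2)) * F c y = y*z*((z-y)*(z+y)) * F c x + x*y*((y-x)*(y+x)) * F c z
        + ((z-y)*(y-x)*(z-x)) * (-c 0 * (x+y+z) + c 2 * (x*y*z) + -c 4 * (x*y*z*(x*y+y*z+z*x))) := by
      simp only [F_eq]; ring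
    have p : 0 < x*z*((z-x)*(z+x)) := by positivity
    have : 0 ≤ x*z*((z-x)*(z+x)) * F c y := by
      have e' : x*z*((z-x)*(z+x)) = x*z*(z^2-x^2) := by ring
      rw [e', e]; positivity
    exact nonneg_of_mul_nonneg_right this p
  · have n3 : 0 ≤ - c 3 := by omega
    have e : (x*z*(z-x)) * F c y = y*z*(z-y) * F c x + x*y*(y-x) * F c z
        + ((z-y)*(y-x)*(z-x)) * (-c 0 + -c 3 * (x*y*z) + -c 4 * (x*y*z*(x+y+z))) := by
      simp only [F_eq]; ring
    have p : 0 < x*z*(z-x) := by positivity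
    have : 0 ≤ x*z*(z-x) * F c y := by
      rw [e]; positivity
    exact nonneg_of_mul_nonneg_right this p
  · have n1 : 0 ≤ - c 1 := by omega
    have e : (x^2*z^2*(z-x)) * F c y = y^2*z^2*(z-y) * F c x + x^2*y^2*(y-x) * F c z
        + ((z-y)*(y-x)*(z-x)) * (-c 0*(x*y+y*z+z*x) + -c 1 * (x*y*z) + -c 4 * (x^2*y^2*z^2)) := by
      simp only [F_eq]; ring
    have p : 0 < x^2*z^2*(z-x) := by positivity
    have : 0 ≤ x^2*z^2*(z-x) * F c y := by
      rw [e]; positivity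
    exact nonneg_of_mul_nonneg_right this p

lemma good_ok {c : ℕ → ℤ} (h : Good c) {x y z : ℤ} (hx : 0 ≤ x) (hxy : x < y) (hyz : y < z)
    (hfx : 0 < F c x) (hfz : 0 < F c z) : 0 ≤ F c y := by
  rcases h with h | h | h
  · exact up_ok h hx hxy hfx
  · exact down_ok h (by omega) hyz hfz
  · exact two_ok h hx hxy hyz hfx hfz

/-- the coefficients -/
def co (m b P s : ℤ) : ℕ → ℤ
  | 0 => P * ((m-1)*(m-2))^2
  | 1 => 2*P*(m*(m^2+b^2)-9*m^2+13*m-6) - s*(((m-1)*(m-2))^2+4*m*(m^2-b^2))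
  | 2 => P*(m^2+b^2-18*m+13) - s*(2*(m-1)*(m^2+b^2)-6*m^2+26*m-12)
  | 3 => -6*P - s*(m^2+b^2-10*m+13)
  | 4 => 4*s
  | _ => 0

def Qp (a b t : ℤ) : ℤ :=
  (a*b-(a+b)*(t+2))*((t+1)^2*t^2) - (a*b-(a+b)*t)*(((t+2)^2-a^2)*((t+2)^2-b^2))

lemma Qp_pos (m b τ : ℤ) : Qp m b (m - 2 + τ) = F (co m b (-m^2) (m+b)) τ := by
  simp only [F_eq, co, Qp]; ring

lemma Qp_neg (m b τ : ℤ) : Qp (-m) b (m - 2 + τ) = F (co m b (m*(m-2*b)) (b-m)) τ := by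
  simp only [F_eq, co, Qp]; ring

instance (c : ℕ → ℤ) : Decidable (Good c) := by
  unfold Good Up Down Two; infer_instance

lemma small : ∀ m ∈ Finset.Icc (0:ℤ) 12, ∀ b ∈ Finset.Icc (-m) m,
    Good (co m b (-m^2) (m+b)) ∧ Good (co m b (m*(m-2*b)) (b-m)) := by
  decide +kernel

lemma up_of {c : ℕ → ℤ} (h0 : c 0 ≤ 0) (h1 : c 1 ≤ 0) (h4 : 0 ≤ c 4) (h : c 3 < 0 → c 2 ≤ 0) :
    Up c := by
  rcases lt_or_ge (c 3) 0 with h3 | h3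
  · refine ⟨4, by norm_num, fun i hi => ?_⟩
    interval_cases i <;> simp_all <;> omega
  · rcases lt_or_ge (c 2) 0 with h2 | h2
    · refine ⟨3, by norm_num, fun i hi => ?_⟩
      interval_cases i <;> simp_all <;> omega
    · refine ⟨2, by norm_num, fun i hi => ?_⟩
      interval_cases i <;> simp_all

lemma down_of {c : ℕ → ℤ} (h0 : 0 ≤ c 0) (h1 : 0 ≤ c 1) (h4 : c 4 ≤ 0) (h : 0 < c 3 → 0 ≤ c 2) :
    Down c := by
  obtain ⟨k, hk, h⟩ := up_of (c := fun i => - c i) (by simpa) (by simpa) (by simpa) (by simpa)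
  refine ⟨k, hk, fun i hi => ?_⟩
  have := h i hi
  simp only [Left.neg_nonpos_iff, Left.nonneg_neg_iff] at this
  constructor
  · intro h; have := this.1 h; omega
  · intro h; have := this.2 h; omega

lemma good_pos (m b : ℤ) (hm : 0 ≤ m) (hb : |b| ≤ m) : Good (co m b (-m^2) (m+b)) := by
  obtain ⟨hb1, hb2⟩ := abs_le.1 hb
  rcases le_or_gt m 12 with h | h
  · exact (small m (by simp; omega) b (by simp; omega)).1
  left
  have hb0 : 0 ≤ b^2 := sq_nonneg b
  have hbm : 0 ≤ m^2 - b^2 := by nlinarith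
  have hs : 0 ≤ m + b := by omega
  generalize m + b = s at *
  apply up_of
  · simp only [co]; nlinarith [sq_nonneg (m*((m-1)*(m-2)))]
  · simp only [co]
    have h1 : 0 ≤ m*(m^2+b^2)-9*m^2+13*m-6 := by nlinarith
    have h2 : 0 ≤ ((m-1)*(m-2))^2+4*m*(m^2-b^2) := by positivity
    nlinarith [mul_nonneg (sq_nonneg m) h1, mul_nonneg hs h2]
  · simp only [co]; omega
  · simp only [co]
    intro h3
    have h4 : 0 ≤ s * (14*m^2-20*m+14) := mul_nonneg hs (by nlinarith)
    have h5 : 0 ≤ m^2 * (m^2+b^2-6*m+1) := mul_nonneg (sq_nonneg m) (by nlinarith)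
    nlinarith [mul_nonneg (by omega : 0 ≤ m - 1) (by linarith : 0 ≤ s*(m^2+b^2-10*m+13) - 6*m^2)]

lemma good_neg (m b : ℤ) (hm : 0 ≤ m) (hb : |b| ≤ m) : Good (co m b (m*(m-2*b)) (b-m)) := by
  obtain ⟨hb1, hb2⟩ := abs_le.1 hb
  rcases le_or_gt m 12 with h | h
  · exact (small m (by simp; omega) b (by simp; omega)).2
  right
  have hb0 : 0 ≤ b^2 := sq_nonneg b
  have hbm : 0 ≤ m^2 - b^2 := by nlinarith
  have h1 : 0 ≤ m*(m^2+b^2)-9*m^2+13*m-6 := by nlinarith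
  have h2 : 0 ≤ ((m-1)*(m-2))^2+4*m*(m^2-b^2) := by positivity
  obtain ⟨r, hr⟩ : ∃ r, r = m - b := ⟨_, rfl⟩
  have hs : 0 ≤ r := by omega
  have hr' : b - m = - r := by omega
  rw [hr']
  rcases le_or_gt 0 (m - 2*b) with hP | hP
  · left
    have hP' : 0 ≤ m*(m-2*b) := mul_nonneg hm hP
    generalize m*(m-2*b) = P at *
    apply down_of
    · simp only [co]; positivity
    · simp only [co]
      nlinarith [mul_nonneg hP' h1, mul_nonneg hs h2]
    · simp only [co]; omega
    · simp only [co]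
      intro h3
      have h4 : 0 ≤ r * (14*m^2-20*m+14) := mul_nonneg hs (by nlinarith)
      have h5 : 0 ≤ P * (m^2+b^2-6*m+1) := mul_nonneg hP' (by nlinarith)
      nlinarith [mul_nonneg (by omega : 0 ≤ m - 1) (by linarith : 0 ≤ r*(m^2+b^2-10*m+13) - 6*P)]
  · right
    have hK : 5 * m^2 ≤ 4 * (m^2+b^2) := by nlinarith
    have hK2 : m^2 + b^2 ≤ 2 * m^2 := by linarith
    have hP' : 0 ≤ -(m*(m-2*b)) := by nlinarith
    generalize m*(m-2*b) = P at *
    refine ⟨?_, ?_, ?_⟩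
    · simp only [co]; nlinarith [mul_nonneg hP' (sq_nonneg ((m-1)*(m-2)))]
    · simp only [co]; omega
    · by_contra hcon
      push Not at hcon
      obtain ⟨g2, -, g1⟩ := hcon
      simp only [co] at g1 g2
      have hb' : m^2 - b^2 = 2*m^2 - (m^2+b^2) := by ring
      rw [hb'] at g1 h2
      generalize m^2+b^2 = K at *
      have hL : 0 < m*K-9*m^2+13*m-6 := by nlinarith
      have hW : 0 ≤ 2*(m-1)*K-6*m^2+26*m-12 := by nlinarith
      rcases le_or_gt (K - 18*m+13) 0 with hY | hY
      · nlinarith [mul_nonneg hP' (by omega : 0 ≤ -(K-18*m+13)), mul_nonneg hs hW]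
      · have main : (((m-1)*(m-2))^2+4*m*(2*m^2-K))*(K-18*m+13)
            ≤ 2*(m*K-9*m^2+13*m-6)*(2*(m-1)*K-6*m^2+26*m-12) := by
          have u1 : ((m-1)*(m-2))^2+4*m*(2*m^2-K) ≤ m^4 := by
            nlinarith [mul_nonneg hm (by linarith : 0 ≤ 4*K-5*m^2), mul_nonneg (sq_nonneg m) (by omega : 0 ≤ m - 13)]
          have hK0 : 0 ≤ K := by nlinarith
          have l1 : K*(m-8) ≤ m*K-9*m^2+13*m-6 := by nlinarith
          have w1 : K*(2*m-7) ≤ 2*(m-1)*K-6*m^2+26*m-12 := by nlinarith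
          have k1 : m^2 ≤ 2*((m-8)*(2*m-7)) := by nlinarith
          calc _ ≤ m^4 * K := mul_le_mul u1 (by linarith) hY.le (by positivity)
            _ = m^2 * (m^2 * K) := by ring
            _ ≤ (2*((m-8)*(2*m-7))) * (K * K) := by
                apply mul_le_mul k1 _ (by positivity) (by nlinarith)
                exact mul_le_mul_of_nonneg_right (by nlinarith) hK0
            _ = 2 * ((K*(m-8))*(K*(2*m-7))) := by ring
            _ ≤ 2 * ((m*K-9*m^2+13*m-6) * (2*(m-1)*K-6*m^2+26*m-12)) := by
                apply mul_le_mul_of_nonneg_left _ (by norm_num)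
                exact mul_le_mul l1 w1 (mul_nonneg hK0 (by omega)) hL.le
            _ = _ := by ring
        -- g1 * Y + g2 * 2L
        generalize ((m-1)*(m-2))^2+4*m*(2*m^2-K) = U at *
        generalize K-18*m+13 = Y at *
        generalize 2*(m-1)*K-6*m^2+26*m-12 = W at *
        generalize m*K-9*m^2+13*m-6 = L at *
        nlinarith [mul_pos hY (by linarith : 0 < 2*P*L - -r*U), mul_pos hL (by linarith : 0 < -(P*Y - -r*W)), mul_nonneg hs (by linarith : 0 ≤ 2*L*W-U*Y)]

end InfB

namespace InfB

noncomputable def h (k t : ℕ) : ℝ := (Nat.choose t ((t + k) / 2) : ℝ) / 2 ^ t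

lemma h_nonneg (k t : ℕ) : 0 ≤ h k t := by unfold h; positivity

lemma h_zero {k t : ℕ} (hp : k % 2 = t % 2) (hk : t < k) : h k t = 0 := by
  unfold h
  rw [Nat.choose_eq_zero_of_lt (by omega)]; simp

lemma H_eq (x : Vtx) (t : ℕ) (h1 : x.1 % 2 = (t:ℤ) % 2) (h2 : x.2 % 2 = (t:ℤ) % 2) :
    H x t = h x.1.natAbs t * h x.2.natAbs t := by
  unfold H
  split_ifs with hc
  · obtain ⟨-, -, c1, c2⟩ := hc
    have key : ∀ a : ℤ, a % 2 = (t:ℤ) % 2 → |a| ≤ t →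
        Nat.choose t (((t : ℤ) + a) / 2).toNat = Nat.choose t ((t + a.natAbs) / 2) := by
      intro a ha hl
      rcases le_total 0 a with h | h
      · congr 1; omega
      · rw [abs_of_nonpos h] at hl
        rw [← Nat.choose_symm (k := (t + a.natAbs) / 2) (by omega)]
        congr 1; omega
    rw [key _ h1 c1, key _ h2 c2]
    unfold h
    have : (4:ℝ) ^ (-(t:ℤ)) = 1 / (2 ^ t * 2 ^ t) := by
      rw [zpow_neg, zpow_natCast, ← mul_pow]; norm_num
    rw [this]; field_simp
  · have : (t:ℤ) < |x.1| ∨ (t:ℤ) < |x.2| := by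
      by_contra hcon
      push Not at hcon
      exact hc ⟨h1, h2, hcon.1, hcon.2⟩
    rw [Int.abs_eq_natAbs, Int.abs_eq_natAbs] at this
    rcases this with h | h
    · rw [h_zero (k := x.1.natAbs) (by omega) (by omega)]; simp
    · rw [h_zero (k := x.2.natAbs) (by omega) (by omega)]; simp

lemma h_pred (a : ℤ) (t : ℕ) (ht : 1 ≤ t) (hp : a % 2 = (t:ℤ) % 2) :
    h (a+1).natAbs (t-1) = h a.natAbs t * ((t - a) / t) := by
  obtain ⟨n, rfl⟩ : ∃ n, t = n + 1 := ⟨t - 1, by omega⟩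
  simp only [Nat.add_sub_cancel]
  unfold h
  have hn : ((n:ℝ) + 1) ≠ 0 := by positivity
  rcases le_or_gt 0 a with h0 | h0
  · obtain ⟨k, rfl⟩ := Int.eq_ofNat_of_zero_le h0
    have e1 : (n + ((k:ℤ)+1).natAbs) / 2 = (n + 1 + k) / 2 := by omega
    have e2 : ((k:ℤ)).natAbs = k := by omega
    rw [e1, e2]
    obtain ⟨r, hr⟩ : ∃ r, n + 1 + k = 2 * r := ⟨(n+1+k)/2, by omega⟩
    rw [hr, Nat.mul_div_cancel_left r (by norm_num)]
    have hkr : ((k:ℤ):ℝ) = 2 * r - n - 1 := by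
      have : (n:ℝ) + 1 + k = 2 * r := by exact_mod_cast hr
      push_cast; linarith
    have key : (Nat.choose n r : ℝ) * (n + 1) = Nat.choose (n+1) r * (n + 1 - r) := by
      rcases le_or_gt r (n+1) with hle | hlt
      · have := Nat.choose_mul_succ_eq n r
        have h' : ((Nat.choose n r * (n+1) : ℕ) : ℝ) = ((Nat.choose (n+1) r * (n + 1 - r) : ℕ):ℝ) := by
          rw [this]
        push_cast [Nat.cast_sub hle] at h'
        exact h'
      · rw [Nat.choose_eq_zero_of_lt hlt, Nat.choose_eq_zero_of_lt (by omega : n < r)]; simp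
    rw [hkr]
    push_cast
    rw [pow_succ]
    field_simp
    linarith
  · obtain ⟨k, hk⟩ : ∃ k : ℕ, a = -((k:ℤ)+1) := ⟨(-a-1).toNat, by omega⟩
    subst hk
    have e1 : (-((k:ℤ)+1)+1).natAbs = k := by omega
    have e2 : (-((k:ℤ)+1)).natAbs = k + 1 := by omega
    rw [e1, e2]
    obtain ⟨r, hr⟩ : ∃ r, n + k = 2 * r := ⟨(n+k)/2, by omega⟩
    have e3 : (n + 1 + (k + 1)) / 2 = r + 1 := by omega
    have e4 : (n + k) / 2 = r := by omega
    rw [e3, e4]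
    have hkr : (k:ℝ) = 2 * r - n := by
      have : (n:ℝ) + k = 2 * r := by exact_mod_cast hr
      linarith
    have key : ((n:ℝ) + 1) * Nat.choose n r = Nat.choose (n+1) (r+1) * (r + 1) := by
      exact_mod_cast Nat.add_one_mul_choose_eq n r
    push_cast
    rw [hkr, pow_succ]
    field_simp
    linarith

lemma h_step (k t : ℕ) (hp : k % 2 = t % 2) :
    h k (t+2) * (((t:ℝ)+2)^2 - k^2) = h k t * ((t+1)*(t+2)) := by
  rcases le_or_gt k t with hk | hk
  · obtain ⟨j, hj⟩ : ∃ j, t = k + 2 * j := ⟨(t-k)/2, by omega⟩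
    unfold h
    have e1 : (t + 2 + k) / 2 = k + j + 1 := by omega
    have e2 : (t + k) / 2 = k + j := by omega
    rw [e1, e2]
    have k1 : ((t:ℝ) + 1 + 1) * Nat.choose (t+1) (k+j) = Nat.choose (t+2) (k+j+1) * (k + j + 1) := by
      exact_mod_cast Nat.add_one_mul_choose_eq (t+1) (k+j)
    have k2 : (Nat.choose t (k+j) : ℝ) * (t + 1) = Nat.choose (t+1) (k+j) * (j + 1) := by
      have := Nat.choose_mul_succ_eq t (k+j)
      have e : t + 1 - (k + j) = j + 1 := by omega
      rw [e] at this
      exact_mod_cast this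
    have ht : (t:ℝ) = k + 2 * j := by exact_mod_cast hj
    have e : ((t:ℝ)+2)^2 - k^2 = 4 * ((k + j + 1) * (j + 1)) := by rw [ht]; ring
    rw [e, pow_add]
    field_simp
    linear_combination (-4 * ((j:ℝ)+1)) * k1 - 4 * ((t:ℝ)+2) * k2
  · rw [h_zero hp hk]
    rcases (by omega : k = t + 2 ∨ t + 2 < k) with h | h
    · subst h; push_cast; ring
    · rw [h_zero (by omega) h]; ring

noncomputable def G (a b : ℤ) (t : ℕ) : ℝ :=
  h a.natAbs t * h b.natAbs t * (((t:ℝ) - a) * (t - b) / t^2 - 1)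

lemma INF_eq (x A : Vtx) (hx : inV x) (hA : A ∈ DIRset) (t : ℕ) (ht : t ∈ Xdom x) :
    INF x A t = G (A.1 * x.1) (A.2 * x.2) t := by
  obtain ⟨h1, h2⟩ := ht
  unfold inV at hx
  obtain ⟨x1, x2⟩ := x
  obtain ⟨A1, A2⟩ := A
  have hA' : (A1 = 1 ∨ A1 = -1) ∧ (A2 = 1 ∨ A2 = -1) := by
    simp [DIRset] at hA; omega
  simp only at *
  have ht1 : ((t - 1 : ℕ) : ℤ) = t - 1 := by omega
  unfold INF G
  have g : ∀ y B : ℤ, (B = 1 ∨ B = -1) → y % 2 = (t:ℤ) % 2 →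
      (y + B) % 2 = ((t-1 : ℕ) : ℤ) % 2 ∧ y.natAbs = (B*y).natAbs ∧ (y + B).natAbs = (B*y+1).natAbs
      ∧ (B*y) % 2 = (t:ℤ) % 2 := by
    intro y B hB hy
    rcases hB with rfl | rfl <;> omega
  obtain ⟨p1, p2, p3, p4⟩ := g x1 A1 hA'.1 (by omega)
  obtain ⟨q1, q2, q3, q4⟩ := g x2 A2 hA'.2 (by omega)
  rw [H_eq _ _ (by simpa using p1) (by simpa using q1), H_eq _ _ (by simpa using h2.symm) (by simp; omega)]
  simp only [Prod.fst_add, Prod.snd_add]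
  rw [p3, q3, p2, q2, h_pred _ t h1 p4, h_pred _ t h1 q4]
  have : (t:ℝ) ≠ 0 := by positivity
  field_simp

lemma G_comm (a b : ℤ) (t : ℕ) : G a b t = G b a t := by
  unfold G; ring

lemma G_step (a b : ℤ) (hba : b.natAbs ≤ a.natAbs) (t : ℕ) (ht : 1 ≤ t)
    (pa : a % 2 = (t:ℤ) % 2) (pb : b % 2 = (t:ℤ) % 2) (hm : a.natAbs ≤ t + 2) :
    (0 ≤ Qp a b t → 0 ≤ G a b (t+2) - G a b t) ∧ (Qp a b t ≤ 0 → G a b (t+2) - G a b t ≤ 0) := by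
  have ht0 : (0:ℝ) < t := by positivity
  have sa := h_step a.natAbs t (by omega)
  have sb := h_step b.natAbs t (by omega)
  have na : ((a.natAbs:ℝ))^2 = (a:ℝ)^2 := by
    rw [Nat.cast_natAbs]; push_cast; rw [sq_abs]
  have nb : ((b.natAbs:ℝ))^2 = (b:ℝ)^2 := by
    rw [Nat.cast_natAbs]; push_cast; rw [sq_abs]
  rw [na] at sa
  rw [nb] at sb
  rcases (by omega : a.natAbs = t + 2 ∨ a.natAbs ≤ t) with hc | hc
  · have z : G a b t = 0 := by
      unfold G; rw [h_zero (k := a.natAbs) (by omega) (by omega)]; ring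
    rw [z, sub_zero]
    have aa : (a:ℝ)^2 = ((t:ℝ)+2)^2 := by rw [← na, hc]; push_cast; ring
    have aZ : a^2 = ((t:ℤ)+2)^2 := by
      rw [← Int.natAbs_sq, hc]; push_cast; ring
    have eQ : Qp a b t = (a*b-(a+b)*((t:ℤ)+2))*(((t:ℤ)+1)^2*(t:ℤ)^2) := by
      unfold Qp; rw [aZ]; ring
    have eG : G a b (t+2) = h a.natAbs (t+2) * h b.natAbs (t+2) / ((t:ℝ)+2)^2 *
        ((a*b-(a+b)*((t:ℤ)+2) : ℤ) : ℝ) := by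
      unfold G; push_cast; field_simp; ring
    rw [eQ, eG]
    have c1 : 0 ≤ h a.natAbs (t+2) * h b.natAbs (t+2) / ((t:ℝ)+2)^2 := by
      have := h_nonneg a.natAbs (t+2)
      have := h_nonneg b.natAbs (t+2)
      positivity
    have c2 : (0:ℤ) < ((t:ℤ)+1)^2*(t:ℤ)^2 := by positivity
    constructor
    · intro hq
      exact mul_nonneg c1 (by exact_mod_cast nonneg_of_mul_nonneg_left hq c2)
    · intro hq
      exact mul_nonpos_of_nonneg_of_nonpos c1 (by exact_mod_cast nonpos_of_mul_nonpos_left hq c2)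
  · have lt : ∀ d : ℤ, d.natAbs ≤ t → ((d.natAbs:ℝ))^2 = (d:ℝ)^2 → 0 < ((t:ℝ)+2)^2 - (d:ℝ)^2 := by
      intro d hd e
      rw [← e]
      have : (d.natAbs:ℝ) ≤ t := by exact_mod_cast hd
      have : (0:ℝ) ≤ d.natAbs := by positivity
      nlinarith
    have la := lt a hc na
    have lb := lt b (by omega) nb
    have ea : h a.natAbs (t+2) = h a.natAbs t * ((t+1)*(t+2)) / (((t:ℝ)+2)^2 - (a:ℝ)^2) := by
      rw [← sa]; field_simp
    have eb : h b.natAbs (t+2) = h b.natAbs t * ((t+1)*(t+2)) / (((t:ℝ)+2)^2 - (b:ℝ)^2) := by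
      rw [← sb]; field_simp
    have key : G a b (t+2) - G a b t = h a.natAbs t * h b.natAbs t /
        ((((t:ℝ)+2)^2 - (a:ℝ)^2) * (((t:ℝ)+2)^2 - (b:ℝ)^2) * t^2) * (Qp a b t : ℝ) := by
      unfold G Qp
      rw [ea, eb]
      have := la.ne'
      have := lb.ne'
      push_cast
      generalize h a.natAbs t = u
      generalize h b.natAbs t = v
      field_simp
      ring
    rw [key]
    have c1 : 0 ≤ h a.natAbs t * h b.natAbs t /
        ((((t:ℝ)+2)^2 - (a:ℝ)^2) * (((t:ℝ)+2)^2 - (b:ℝ)^2) * t^2) := by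
      have := h_nonneg a.natAbs t
      have := h_nonneg b.natAbs t
      positivity
    constructor
    · intro hq
      exact mul_nonneg c1 (by exact_mod_cast hq)
    · intro hq
      exact mul_nonpos_of_nonneg_of_nonpos c1 (by exact_mod_cast hq)

lemma Qp_conv (a b : ℤ) (hba : b.natAbs ≤ a.natAbs) {x y z : ℤ} (hx : a.natAbs ≤ x + 2)
    (hxy : x < y) (hyz : y < z) (h1 : 0 < Qp a b x) (h2 : 0 < Qp a b z) : 0 ≤ Qp a b y := by
  rcases le_total 0 a with h0 | h0
  · have e : ∀ w, Qp a b w = F (co a b (-a^2) (a+b)) (w - a + 2) := by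
      intro w; rw [← Qp_pos]; congr 1; ring
    rw [e] at *
    exact good_ok (good_pos a b h0 (by rw [Int.abs_eq_natAbs]; omega)) (by omega) (by omega) (by omega) h1 h2
  · obtain ⟨m, rfl⟩ : ∃ m, a = -m := ⟨-a, by ring⟩
    have e : ∀ w, Qp (-m) b w = F (co m b (m*(m-2*b)) (b-m)) (w - m + 2) := by
      intro w; rw [← Qp_neg]; congr 1; ring
    rw [e] at *
    exact good_ok (good_neg m b (by omega) (by rw [Int.abs_eq_natAbs]; omega)) (by omega) (by omega) (by omega) h1 h2

lemma G_conv (a b : ℤ) (hba : b.natAbs ≤ a.natAbs) (hp : a % 2 = b % 2) {x y z : ℕ} (hx0 : 1 ≤ x)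
    (px : a % 2 = (x:ℤ) % 2) (py : a % 2 = (y:ℤ) % 2) (pz : a % 2 = (z:ℤ) % 2)
    (hxy : x < y) (hyz : y < z)
    (h1 : 0 < G a b (x+2) - G a b x) (h2 : 0 < G a b (z+2) - G a b z) :
    0 ≤ G a b (y+2) - G a b y := by
  have hm : a.natAbs ≤ x + 2 := by
    by_contra hcon
    have z1 : G a b x = 0 := by
      unfold G; rw [h_zero (k := a.natAbs) (by omega) (by omega)]; ring
    have z2 : G a b (x+2) = 0 := by
      unfold G; rw [h_zero (k := a.natAbs) (by omega) (by omega)]; ring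
    rw [z1, z2] at h1; simp at h1
  have q1 : 0 < Qp a b x := by
    by_contra hc
    have := (G_step a b hba x hx0 px (by omega) hm).2 (by omega)
    linarith
  have q2 : 0 < Qp a b z := by
    by_contra hc
    have := (G_step a b hba z (by omega) pz (by omega) (by omega)).2 (by omega)
    linarith
  exact (G_step a b hba y (by omega) py (by omega) (by omega)).1
    (Qp_conv a b hba (by omega) (by omega) (by omega) q1 q2)

lemma steps_le (u : ℕ → ℝ) {i j : ℕ} (hij : i ≤ j) (hs : ∀ n, i ≤ n → n < j → u n ≤ u (n+1)) :
    u i ≤ u j := by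
  induction j, hij using Nat.le_induction with
  | base => exact le_rfl
  | succ n hn ih =>
    exact (ih (fun k h1 h2 => hs k h1 (by omega))).trans (hs n hn (by omega))

lemma comb (g : ℕ → ℝ) (X : Set ℕ) (e : ℕ) (hX : ∀ t, t ∈ X ↔ ∃ n, t = e + 2 * n)
    (hc : ∀ x y z, x < y → y < z → 0 < g (e+2*x+2) - g (e+2*x) → 0 < g (e+2*z+2) - g (e+2*z) →
      0 ≤ g (e+2*y+2) - g (e+2*y)) : BimodalOn g X := by
  have mono : ∀ S : Set ℕ,
      (∀ n, ∀ s ∈ S, ∀ t ∈ S, s ≤ e + 2*n → e + 2*n+2 ≤ t → 0 ≤ g (e+2*n+2) - g (e+2*n)) → MonotoneOn g (X ∩ S) := by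
    rintro S hd s ⟨hs, hs'⟩ t ⟨ht, ht'⟩ hst
    obtain ⟨n, rfl⟩ := (hX s).1 hs
    obtain ⟨k, rfl⟩ := (hX t).1 ht
    exact steps_le (fun n => g (e + 2*n)) (by omega) (fun l h1 h2 => by
      have := hd l _ hs' _ ht' (by omega) (by omega)
      show g (e+2*l) ≤ g (e+2*l+2)
      linarith)
  have anti : ∀ S : Set ℕ,
      (∀ n, ∀ s ∈ S, ∀ t ∈ S, s ≤ e + 2*n → e + 2*n+2 ≤ t → g (e+2*n+2) - g (e+2*n) ≤ 0) → AntitoneOn g (X ∩ S) := by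
    rintro S hd s ⟨hs, hs'⟩ t ⟨ht, ht'⟩ hst
    obtain ⟨n, rfl⟩ := (hX s).1 hs
    obtain ⟨k, rfl⟩ := (hX t).1 ht
    exact neg_le_neg_iff.1 (steps_le (fun n => - g (e + 2*n)) (by omega) (fun l h1 h2 => by
      have := hd l _ hs' _ ht' (by omega) (by omega)
      show - g (e+2*l) ≤ - g (e+2*l+2)
      linarith))
  have mem : ∀ n, e + 2 * n ∈ X := fun n => (hX _).2 ⟨n, rfl⟩
  by_cases hpos : ∃ n, 0 < g (e+2*n+2) - g (e+2*n)
  · classical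
    obtain ⟨n1, h1, hmin⟩ : ∃ n, 0 < g (e+2*n+2) - g (e+2*n) ∧
        ∀ k < n, g (e+2*k+2) - g (e+2*k) ≤ 0 :=
      ⟨Nat.find hpos, Nat.find_spec hpos, fun k hk => not_lt.1 (Nat.find_min hpos hk)⟩
    by_cases hbd : ∃ N, ∀ n, N ≤ n → g (e+2*n+2) - g (e+2*n) ≤ 0
    · obtain ⟨N, hN, hN'⟩ : ∃ N, (∀ n, N ≤ n → g (e+2*n+2) - g (e+2*n) ≤ 0) ∧
          ∀ k < N, ¬ ∀ n, k ≤ n → g (e+2*n+2) - g (e+2*n) ≤ 0 :=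
        ⟨Nat.find hbd, Nat.find_spec hbd, fun k hk => Nat.find_min hbd hk⟩
      have hlt : n1 < N := by
        by_contra hcon
        have := hN n1 (by omega)
        linarith
      have hlast : 0 < g (e+2*(N-1)+2) - g (e+2*(N-1)) := by
        have := hN' (N-1) (by omega)
        push Not at this
        obtain ⟨n, hn, hn'⟩ := this
        have hn2 : n = N - 1 := by
          by_contra hne
          have := hN n (by omega)
          linarith
        rw [← hn2]; exact hn'
      refine ⟨e + 2*n1, mem _, e + 2*N, mem _, by omega, Or.inr (anti _ ?_), Or.inl (mono _ ?_),
        Or.inr (anti _ ?_)⟩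
      · intro n s hs t ht h2 h3
        simp only [Set.mem_Iic] at hs ht
        exact hmin n (by omega)
      · intro n s hs t ht h2 h3
        simp only [Set.mem_Icc] at hs ht
        rcases (by omega : n = n1 ∨ n = N - 1 ∨ (n1 < n ∧ n < N - 1)) with rfl | rfl | ⟨h4, h5⟩
        · exact h1.le
        · exact hlast.le
        · exact hc n1 n (N-1) h4 h5 h1 hlast
      · intro n s hs t ht h2 h3
        simp only [Set.mem_Ici] at hs ht
        exact hN n (by omega)
    · push Not at hbd
      refine ⟨e + 2*n1, mem _, e + 2*n1, mem _, le_rfl, Or.inr (anti _ ?_), Or.inl (mono _ ?_),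
        Or.inl (mono _ ?_)⟩
      · intro n s hs t ht h2 h3
        simp only [Set.mem_Iic] at hs ht
        exact hmin n (by omega)
      · intro n s hs t ht h2 h3
        simp only [Set.mem_Icc] at hs ht
        omega
      · intro n s hs t ht h2 h3
        simp only [Set.mem_Ici] at hs ht
        rcases (by omega : n = n1 ∨ n1 < n) with rfl | h4
        · exact h1.le
        · obtain ⟨k, hk, hk'⟩ := hbd (n+1)
          exact hc n1 n k h4 (by omega) h1 hk'
  · push Not at hpos
    refine ⟨e + 2*0, mem _, e + 2*0, mem _, le_rfl, Or.inr (anti _ ?_), Or.inr (anti _ ?_),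
        Or.inr (anti _ ?_)⟩ <;> exact fun n _ _ _ _ _ _ => hpos n

lemma main (x : Vtx) (A : Vtx) (a b : ℤ) (hba : b.natAbs ≤ a.natAbs) (hab : a % 2 = b % 2)
    (hax : a % 2 = x.1 % 2) (hG : ∀ t ∈ Xdom x, INF x A t = G a b t) :
    BimodalOn (fun t => INF x A t) (Xdom x) := by
  obtain ⟨e, he1, he2, he3⟩ : ∃ e : ℕ, 1 ≤ e ∧ e ≤ 2 ∧ (e:ℤ) % 2 = x.1 % 2 := by
    rcases Int.emod_two_eq_zero_or_one x.1 with h | h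
    · exact ⟨2, by omega⟩
    · exact ⟨1, by omega⟩
  have hX : ∀ t, t ∈ Xdom x ↔ ∃ n, t = e + 2 * n := by
    intro t
    simp only [Xdom, Set.mem_ofPred_eq]
    constructor
    · rintro ⟨h1, h2⟩
      exact ⟨(t - e) / 2, by omega⟩
    · rintro ⟨n, rfl⟩
      omega
  refine comb _ _ e hX ?_
  have mem : ∀ n, e + 2 * n ∈ Xdom x := fun n => (hX _).2 ⟨n, rfl⟩
  intro p q r hpq hqr
  have mem' : ∀ n, e + 2 * n + 2 ∈ Xdom x := fun n => (hX _).2 ⟨n + 1, by omega⟩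
  rw [hG _ (mem p), hG _ (mem q), hG _ (mem r), hG _ (mem' p), hG _ (mem' q), hG _ (mem' r)]
  exact G_conv a b hba hab (by omega) (by omega) (by omega) (by omega) (by omega) (by omega)

end InfB

/-- For every vertex `x ∈ V` and direction `A ∈ DIR`, the influence
`t ↦ INF(x,A,t)` is bimodal on the positive integers `t ≡ x₁ (mod 2)`. -/
theorem INF_bimodal (x : Vtx) (hx : inV x) (A : Vtx) (hA : A ∈ DIRset) :
    BimodalOn (fun t => INF x A t) (Xdom x) := by
  have hD : (A.1 = 1 ∨ A.1 = -1) ∧ (A.2 = 1 ∨ A.2 = -1) := by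
    obtain ⟨A1, A2⟩ := A
    simp [DIRset] at hA; simp only; omega
  unfold inV at hx
  have p1 : (A.1 * x.1) % 2 = x.1 % 2 := by
    rcases hD.1 with h | h <;> rw [h] <;> omega
  have p2 : (A.2 * x.2) % 2 = x.1 % 2 := by
    rcases hD.2 with h | h <;> rw [h] <;> omega
  rcases le_total (A.2 * x.2).natAbs (A.1 * x.1).natAbs with h | h
  · exact InfB.main x A _ _ h (by omega) p1 (fun t ht => InfB.INF_eq x A hx hA t ht)
  · exact InfB.main x A _ _ h (by omega) p2
      (fun t ht => by rw [InfB.INF_eq x A hx hA t ht, InfB.G_comm])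
end

section
/- For all x ∈ V and all distinct directions A, A' ∈ DIR, the function t ↦ INF(x,A,t) + INF(x,A',t), regarded as a function on the positive integers t with t ≡ x₁ (mod 2), is unimodal. -/
open Finset

noncomputable def qq (a : ℤ) (t : ℕ) : ℝ :=
  if a % 2 = (t : ℤ) % 2 ∧ |a| ≤ (t : ℤ) then
    (2 : ℝ)⁻¹ ^ t * (Nat.choose t (((t : ℤ) + a) / 2).toNat) else 0

lemma H_eq (x : Vtx) (t : ℕ) : H x t = qq x.1 t * qq x.2 t := by
  unfold H qq
  have h4 : (4 : ℝ) ^ (-(t : ℤ)) = (2 : ℝ)⁻¹ ^ t * (2 : ℝ)⁻¹ ^ t := by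
    rw [zpow_neg, zpow_natCast, ← mul_pow, ← inv_pow]; norm_num
  by_cases h1 : x.1 % 2 = (t : ℤ) % 2 ∧ |x.1| ≤ (t : ℤ)
  · by_cases h2 : x.2 % 2 = (t : ℤ) % 2 ∧ |x.2| ≤ (t : ℤ)
    · rw [if_pos h1, if_pos h2, if_pos ⟨h1.1, h2.1, h1.2, h2.2⟩, h4]; ring
    · rw [if_neg h2, if_neg (by tauto)]; ring
  · rw [if_neg h1, if_neg (by tauto)]; ring

lemma qq_nonneg (a : ℤ) (t : ℕ) : 0 ≤ qq a t := by
  unfold qq; split_ifs <;> positivity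

lemma H_nonneg (x : Vtx) (t : ℕ) : 0 ≤ H x t := by
  rw [H_eq]; exact mul_nonneg (qq_nonneg _ _) (qq_nonneg _ _)

lemma qq_ij (i j : ℕ) : qq ((i : ℤ) - j) (i + j) = (2 : ℝ)⁻¹ ^ (i + j) * (Nat.choose (i + j) i) := by
  unfold qq
  rw [if_pos (by push_cast; constructor <;> [omega; (rw [abs_le]; constructor <;> omega)])]
  congr 3
  push_cast; omega

lemma exists_ij (a : ℤ) (t : ℕ) (h1 : a % 2 = (t : ℤ) % 2) (h2 : |a| ≤ (t : ℤ)) :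
    ∃ i j : ℕ, a = (i : ℤ) - j ∧ t = i + j := by
  rw [abs_le] at h2
  exact ⟨(((t : ℤ) + a) / 2).toNat, (((t : ℤ) - a) / 2).toNat, by omega, by omega⟩

lemma qq_step (a : ℤ) (t : ℕ) (h1 : a % 2 = (t : ℤ) % 2) (h2 : |a| ≤ (t : ℤ)) :
    qq a (t + 2) * (((t : ℝ) + 2) ^ 2 - (a : ℝ) ^ 2) = qq a t * (((t : ℝ) + 2) * (t + 1)) := by
  obtain ⟨i, j, rfl, rfl⟩ := exists_ij a t h1 h2
  have e1 : qq ((i : ℤ) - j) (i + j + 2) = qq (((i + 1 : ℕ) : ℤ) - ((j + 1 : ℕ) : ℤ)) ((i + 1) + (j + 1)) := by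
    congr 1
    · push_cast; ring
    · ring
  rw [e1, qq_ij, qq_ij]
  have c1 : (i + j + 2) * Nat.choose (i + j + 1) i = Nat.choose (i + 1 + (j + 1)) (i + 1) * (i + 1) := by
    have := Nat.add_one_mul_choose_eq (i + j + 1) i
    rw [show i + 1 + (j + 1) = i + j + 1 + 1 by ring]; exact this
  have c2 : (i + j + 1) * Nat.choose (i + j) i = Nat.choose (i + j + 1) i * (j + 1) := by
    have := Nat.choose_mul_succ_eq (i + j) i
    rw [show i + j + 1 - i = j + 1 by omega] at this
    rw [mul_comm]; exact this
  have c1' : ((i : ℝ) + j + 2) * (Nat.choose (i + j + 1) i : ℝ) = Nat.choose (i + 1 + (j + 1)) (i + 1) * ((i : ℝ) + 1) := by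
    exact_mod_cast c1
  have c2' : ((i : ℝ) + j + 1) * (Nat.choose (i + j) i : ℝ) = Nat.choose (i + j + 1) i * ((j : ℝ) + 1) := by
    exact_mod_cast c2
  have e2 : (2 : ℝ)⁻¹ ^ (i + 1 + (j + 1)) = (2 : ℝ)⁻¹ ^ (i + j) / 4 := by
    rw [show i + 1 + (j + 1) = (i + j) + 2 by ring, pow_add]; ring
  rw [e2]
  push_cast
  set P := (2 : ℝ)⁻¹ ^ (i + j)
  linear_combination (-P * (j + 1)) * c1' - (P * (i + j + 2)) * c2'

lemma qq_zero_of_lt (a : ℤ) (t : ℕ) (h : (t : ℤ) < |a|) : qq a t = 0 := by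
  unfold qq; rw [if_neg (by rintro ⟨_, h2⟩; omega)]

lemma qq_back (a e : ℤ) (he : e = 1 ∨ e = -1) (t : ℕ) :
    qq (a + e) t * ((t : ℝ) + 1) = qq a (t + 1) * ((t : ℝ) + 1 - e * a) := by
  by_cases hp : a % 2 = ((t + 1 : ℕ) : ℤ) % 2
  swap
  · unfold qq; rw [if_neg, if_neg]
    · simp
    · tauto
    · rintro ⟨h, _⟩; apply hp; push_cast; omega
  by_cases hb : |a| ≤ ((t + 1 : ℕ) : ℤ)
  swap
  · rw [qq_zero_of_lt a (t + 1) (by omega), qq_zero_of_lt (a + e) t]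
    · simp
    · push_cast at hb; rw [abs_le] at hb; rw [lt_abs]; omega
  obtain ⟨i, j, rfl, hij⟩ := exists_ij a (t + 1) hp hb
  have ht : (t : ℝ) + 1 = i + j := by exact_mod_cast hij
  rcases he with rfl | rfl
  · rcases j with _ | j
    · rw [qq_zero_of_lt _ t]
      · rw [ht]; push_cast; ring
      · rw [lt_abs]; push_cast; omega
    · have ht' : t = i + j := by omega
      subst ht'
      have e1 : qq ((i : ℤ) - ((j + 1 : ℕ) : ℤ) + 1) (i + j) = qq ((i : ℤ) - j) (i + j) := by
        congr 1; push_cast; ring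
      rw [e1, show i + j + 1 = i + (j + 1) by ring, qq_ij, qq_ij]
      have c2 := Nat.choose_mul_succ_eq (i + j) i
      rw [show i + j + 1 - i = j + 1 by omega] at c2
      have c2' : (Nat.choose (i + j) i : ℝ) * ((i : ℝ) + j + 1) = Nat.choose (i + (j + 1)) i * ((j : ℝ) + 1) := by
        exact_mod_cast c2
      rw [show i + (j + 1) = (i + j) + 1 by ring] at c2' ⊢
      rw [pow_succ]
      push_cast
      linear_combination ((2 : ℝ)⁻¹ ^ (i + j)) * c2'
  · rcases i with _ | i
    · rw [qq_zero_of_lt _ t]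
      · rw [ht]; push_cast; ring
      · rw [lt_abs]; push_cast; omega
    · have ht' : t = i + j := by omega
      subst ht'
      have e1 : qq (((i + 1 : ℕ) : ℤ) - (j : ℤ) + -1) (i + j) = qq ((i : ℤ) - j) (i + j) := by
        congr 1; push_cast; ring
      rw [e1, show i + j + 1 = (i + 1) + j by ring, qq_ij, qq_ij]
      have c2 := Nat.add_one_mul_choose_eq (i + j) i
      rw [show i + j + 1 = i + 1 + j by ring] at c2
      have c2' : ((i : ℝ) + 1 + j) * (Nat.choose (i + j) i : ℝ) = Nat.choose (i + 1 + j) (i + 1) * ((i : ℝ) + 1) := by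
        exact_mod_cast c2
      rw [show (2 : ℝ)⁻¹ ^ (i + 1 + j) = (2 : ℝ)⁻¹ ^ (i + j) * 2⁻¹ by
        rw [show i + 1 + j = i + j + 1 by ring, pow_succ]]
      push_cast
      linear_combination ((2 : ℝ)⁻¹ ^ (i + j)) * c2'

lemma INF_eq (x : Vtx) (e1 e2 : ℤ) (h1 : e1 = 1 ∨ e1 = -1) (h2 : e2 = 1 ∨ e2 = -1)
    (t : ℕ) (ht : 1 ≤ t) :
    INF x (e1, e2) t = H x t * ((1 - e1 * x.1 / t) * (1 - e2 * x.2 / t) - 1) := by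
  obtain ⟨s, rfl⟩ : ∃ s, t = s + 1 := ⟨t - 1, by omega⟩
  unfold INF
  rw [H_eq, H_eq]
  have hs : ((s + 1 : ℕ) : ℝ) ≠ 0 := by positivity
  have a1 : qq (x.1 + e1) s = qq x.1 (s + 1) * (1 - e1 * x.1 / ((s + 1 : ℕ) : ℝ)) := by
    have := qq_back x.1 e1 h1 s
    field_simp
    push_cast at hs ⊢
    linear_combination this
  have a2 : qq (x.2 + e2) s = qq x.2 (s + 1) * (1 - e2 * x.2 / ((s + 1 : ℕ) : ℝ)) := by
    have := qq_back x.2 e2 h2 s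
    field_simp
    push_cast at hs ⊢
    linear_combination this
  simp only [Nat.add_sub_cancel, Prod.fst_add, Prod.snd_add]
  rw [a1, a2]; ring

lemma step_induct (f : ℕ → ℝ) (a : ℕ) (n : ℕ)
    (h : ∀ k < n, f (a + 2 * k) ≤ f (a + 2 * k + 2)) : f a ≤ f (a + 2 * n) := by
  induction n with
  | zero => simp
  | succ n ih =>
    exact (ih fun k hk => h k (by omega)).trans (h n (by omega))

lemma unimodal_of (x : Vtx) (f : ℕ → ℝ) (P : ℕ → Prop) (c : ℝ)
    (hex : ∃ t ∈ Xdom x, P t)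
    (hup : ∀ t ∈ Xdom x, P t → P (t + 2))
    (hinc : ∀ t ∈ Xdom x, ¬ P t → f t ≤ f (t + 2))
    (hdec : ∀ t ∈ Xdom x, P t → f (t + 2) ≤ f t)
    (g : ℕ → ℝ) (hg : ∀ t ∈ Xdom x, g t = c * f t) :
    UnimodalOn g (Xdom x) := by
  classical
  have hX : ∀ a ∈ Xdom x, ∀ k, a + 2 * k ∈ Xdom x := by
    rintro a ⟨h1, h2⟩ k
    exact ⟨by omega, by push_cast; omega⟩
  have hsplit : ∀ a ∈ Xdom x, ∀ b ∈ Xdom x, a ≤ b → ∃ n, b = a + 2 * n := by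
    rintro a ⟨h1, h2⟩ b ⟨h3, h4⟩ hab
    exact ⟨(b - a) / 2, by omega⟩
  obtain ⟨t1, ⟨ht1, hP1⟩, hmin⟩ : ∃ t1, (t1 ∈ Xdom x ∧ P t1) ∧ ∀ m < t1, ¬ (m ∈ Xdom x ∧ P m) :=
    ⟨Nat.find hex, Nat.find_spec hex, fun m hm => Nat.find_min hex hm⟩
  have hall : ∀ n, P (t1 + 2 * n) := by
    intro n
    induction n with
    | zero => exact hP1
    | succ n ih => exact hup _ (hX _ ht1 n) ih
  have m1 : ∀ a ∈ Xdom x, ∀ b ∈ Xdom x, a ≤ b → b ≤ t1 → f a ≤ f b := by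
    intro a ha b hb hab hbt
    obtain ⟨n, rfl⟩ := hsplit a ha b hb hab
    apply step_induct
    intro k hk
    exact hinc _ (hX a ha k) fun hP => hmin (a + 2 * k) (by omega) ⟨hX a ha k, hP⟩
  have m2 : ∀ a ∈ Xdom x, ∀ b ∈ Xdom x, a ≤ b → t1 ≤ a → f b ≤ f a := by
    intro a ha b hb hab hat
    obtain ⟨n, rfl⟩ := hsplit a ha b hb hab
    obtain ⟨r, rfl⟩ := hsplit t1 ht1 a ha hat
    have := step_induct (fun t => - f t) (t1 + 2 * r) n (by
      intro k hk
      have h3 := hdec _ (hX _ ha k) (by have := hall (r + k); rwa [show t1 + 2 * r + 2 * k = t1 + 2 * (r + k) by ring])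
      linarith)
    linarith
  refine ⟨t1, ht1, ?_, ?_⟩
  · rcases le_total 0 c with hc | hc
    · left; rintro a ⟨ha, ha'⟩ b ⟨hb, hb'⟩ hab
      rw [hg a ha, hg b hb]
      exact mul_le_mul_of_nonneg_left (m1 a ha b hb hab hb') hc
    · right; rintro a ⟨ha, ha'⟩ b ⟨hb, hb'⟩ hab
      rw [hg a ha, hg b hb]
      exact mul_le_mul_of_nonpos_left (m1 a ha b hb hab hb') hc
  · rcases le_total 0 c with hc | hc
    · right; rintro a ⟨ha, ha'⟩ b ⟨hb, hb'⟩ hab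
      rw [hg a ha, hg b hb]
      exact mul_le_mul_of_nonneg_left (m2 a ha b hb hab ha') hc
    · left; rintro a ⟨ha, ha'⟩ b ⟨hb, hb'⟩ hab
      rw [hg a ha, hg b hb]
      exact mul_le_mul_of_nonpos_left (m2 a ha b hb hab ha') hc

/-- A cubic with nonneg constant and leading coefficient, nonpositive at `m`, changes sign once. -/
lemma cubic_up (α β γ δ m s u : ℝ) (hα : 0 ≤ α) (hδ : 0 ≤ δ) (hm : 0 < m) (hms : m < s) (hsu : s ≤ u)
    (h0 : α * m ^ 3 - β * m ^ 2 + γ * m + δ ≤ 0)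
    (h1 : 0 ≤ α * s ^ 3 - β * s ^ 2 + γ * s + δ) :
    0 ≤ α * u ^ 3 - β * u ^ 2 + γ * u + δ := by
  have key : m * s * (s - m) * (α * u ^ 3 - β * u ^ 2 + γ * u + δ)
      = m * u * (u - m) * (α * s ^ 3 - β * s ^ 2 + γ * s + δ)
        + s * u * (u - s) * (-(α * m ^ 3 - β * m ^ 2 + γ * m + δ))
        + (u - s) * (s - m) * (u - m) * (α * m * s * u + δ) := by ring
  have hs : 0 < s := hm.trans hms
  have hu : 0 < u := hs.trans_le hsu
  have a1 : 0 < s - m := by linarith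
  have a2 : 0 ≤ u - s := by linarith
  have a3 : 0 < u - m := by linarith
  have a4 : 0 ≤ -(α * m ^ 3 - β * m ^ 2 + γ * m + δ) := by linarith
  have : 0 ≤ m * s * (s - m) * (α * u ^ 3 - β * u ^ 2 + γ * u + δ) := by
    rw [key]; positivity
  exact nonneg_of_mul_nonneg_right this (by positivity)

def DD (k : ℕ) (X Y s : ℝ) : ℝ :=
  s ^ k * (s ^ 2 - X) * (s ^ 2 - Y) - s ^ 2 * (s - 1) ^ 2 * (s - 2) ^ k

lemma DD1 (X Y s : ℝ) : DD 1 X Y s = s * (4 * s ^ 3 - (5 + X + Y) * s ^ 2 + 2 * s + X * Y) := by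
  unfold DD; ring

lemma DD2 (X Y s : ℝ) : DD 2 X Y s = s ^ 2 * (6 * s ^ 3 - (13 + X + Y) * s ^ 2 + 12 * s + (X * Y - 4)) := by
  unfold DD; ring

lemma gen (x : Vtx) (hx : inV x) (k : ℕ) (c : ℝ) (g : ℕ → ℝ)
    (hlarge : ∀ s : ℝ, 13 + (x.1 : ℝ) ^ 2 + (x.2 : ℝ) ^ 2 ≤ s → 0 ≤ DD k ((x.1 : ℝ) ^ 2) ((x.2 : ℝ) ^ 2) s)
    (hup : ∀ s u : ℝ, (|x.1| : ℤ) < s → (|x.2| : ℤ) < s → s ≤ u →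
      0 ≤ DD k ((x.1 : ℝ) ^ 2) ((x.2 : ℝ) ^ 2) s → 0 ≤ DD k ((x.1 : ℝ) ^ 2) ((x.2 : ℝ) ^ 2) u)
    (hg : ∀ t : ℕ, 1 ≤ t → g t = c * (H x t / (t : ℝ) ^ k)) :
    UnimodalOn g (Xdom x) := by
  have hcmp : ∀ t ∈ Xdom x, |x.1| ≤ (t : ℤ) → |x.2| ≤ (t : ℤ) →
      ∃ Q : ℝ, 0 < Q ∧ (H x t / (t : ℝ) ^ k - H x (t + 2) / ((t + 2 : ℕ) : ℝ) ^ k) * Q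
        = H x t * DD k ((x.1 : ℝ) ^ 2) ((x.2 : ℝ) ^ 2) (t + 2) := by
    rintro t ⟨ht1, ht2⟩ h1 h2
    have q1 := qq_step x.1 t ht2.symm h1
    have q2 := qq_step x.2 t (by rw [ht2]; exact hx.symm) h2
    have b1 : |(x.1 : ℝ)| ≤ t := by exact_mod_cast h1
    have b2 : |(x.2 : ℝ)| ≤ t := by exact_mod_cast h2
    have p1 : 0 < ((t : ℝ) + 2) ^ 2 - (x.1 : ℝ) ^ 2 := by
      rw [← sq_abs (x.1 : ℝ)]; nlinarith [abs_nonneg (x.1 : ℝ)]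
    have p2 : 0 < ((t : ℝ) + 2) ^ 2 - (x.2 : ℝ) ^ 2 := by
      rw [← sq_abs (x.2 : ℝ)]; nlinarith [abs_nonneg (x.2 : ℝ)]
    have ht : (0 : ℝ) < t := by exact_mod_cast ht1
    refine ⟨(t : ℝ) ^ k * ((t : ℝ) + 2) ^ k * (((t : ℝ) + 2) ^ 2 - (x.1 : ℝ) ^ 2) * (((t : ℝ) + 2) ^ 2 - (x.2 : ℝ) ^ 2), by positivity, ?_⟩
    have hH : H x (t + 2) * ((((t : ℝ) + 2) ^ 2 - (x.1 : ℝ) ^ 2) * (((t : ℝ) + 2) ^ 2 - (x.2 : ℝ) ^ 2))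
        = H x t * (((t : ℝ) + 2) * (t + 1)) ^ 2 := by
      rw [H_eq, H_eq]
      calc _ = (qq x.1 (t + 2) * (((t : ℝ) + 2) ^ 2 - (x.1 : ℝ) ^ 2)) * (qq x.2 (t + 2) * (((t : ℝ) + 2) ^ 2 - (x.2 : ℝ) ^ 2)) := by ring
        _ = _ := by rw [q1, q2]; ring
    unfold DD
    push_cast
    rw [show (t : ℝ) + 2 - 2 = t by ring, show (t : ℝ) + 2 - 1 = t + 1 by ring]
    have hn1 : (t : ℝ) ^ k ≠ 0 := by positivity
    have hn2 : ((t : ℝ) + 2) ^ k ≠ 0 := by positivity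
    generalize hT : (t : ℝ) ^ k = T at *
    generalize hS : ((t : ℝ) + 2) ^ k = S at *
    have e : (H x t / T - H x (t + 2) / S) * (T * S * (((t : ℝ) + 2) ^ 2 - (x.1 : ℝ) ^ 2) * (((t : ℝ) + 2) ^ 2 - (x.2 : ℝ) ^ 2))
      = (H x t * S - H x (t + 2) * T) * ((((t : ℝ) + 2) ^ 2 - (x.1 : ℝ) ^ 2) * (((t : ℝ) + 2) ^ 2 - (x.2 : ℝ) ^ 2)) := by
      have : H x t / T - H x (t + 2) / S = (H x t * S - H x (t + 2) * T) / (T * S) := by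
        field_simp
      rw [this]
      rw [mul_assoc (T * S), ← mul_assoc, div_mul_cancel₀ _ (mul_ne_zero hn1 hn2)]
    rw [e]
    linear_combination (-T) * hH
  refine unimodal_of x (fun t => H x t / (t : ℝ) ^ k)
    (fun t => |x.1| ≤ (t : ℤ) ∧ |x.2| ≤ (t : ℤ) ∧ 0 ≤ DD k ((x.1 : ℝ) ^ 2) ((x.2 : ℝ) ^ 2) (t + 2)) c ?_ ?_ ?_ ?_ g
    (fun t ht => hg t ht.1)
  · have z1 : |x.1| ≤ x.1 ^ 2 := by
      rw [← sq_abs]; rcases (abs_nonneg x.1).eq_or_lt with h | h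
      · rw [← h]; norm_num
      · nlinarith
    have z2 : |x.2| ≤ x.2 ^ 2 := by
      rw [← sq_abs]; rcases (abs_nonneg x.2).eq_or_lt with h | h
      · rw [← h]; norm_num
      · nlinarith
    have z3 : 0 ≤ |x.1| := abs_nonneg _
    have z4 : 0 ≤ |x.2| := abs_nonneg _
    have z5 : |x.1| % 2 = x.1 % 2 := by
      rcases abs_choice x.1 with h | h <;> rw [h]; omega
    have hN : (((|x.1| + 2 * (13 + x.1 ^ 2 + x.2 ^ 2)).toNat : ℕ) : ℤ) = |x.1| + 2 * (13 + x.1 ^ 2 + x.2 ^ 2) :=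
      Int.toNat_of_nonneg (by linarith)
    generalize (|x.1| + 2 * (13 + x.1 ^ 2 + x.2 ^ 2)).toNat = N at hN
    refine ⟨N, ⟨by omega, by omega⟩, by omega, by omega, hlarge _ ?_⟩
    have : (13 + x.1 ^ 2 + x.2 ^ 2 : ℤ) ≤ (N : ℤ) + 2 := by omega
    exact_mod_cast this
  · rintro t ht ⟨h1, h2, h3⟩
    refine ⟨by push_cast; omega, by push_cast; omega, hup _ _ ?_ ?_ ?_ h3⟩
    · have : |x.1| < (t : ℤ) + 2 := by omega
      exact_mod_cast this
    · have : |x.2| < (t : ℤ) + 2 := by omega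
      exact_mod_cast this
    · push_cast; linarith
  · intro t ht hP
    by_cases h1 : |x.1| ≤ (t : ℤ)
    · by_cases h2 : |x.2| ≤ (t : ℤ)
      · have h3 : DD k ((x.1 : ℝ) ^ 2) ((x.2 : ℝ) ^ 2) (t + 2) < 0 := by
          by_contra h; exact hP ⟨h1, h2, not_lt.mp h⟩
        obtain ⟨Q, hQ, e⟩ := hcmp t ht h1 h2
        have := mul_nonpos_of_nonneg_of_nonpos (H_nonneg x t) h3.le
        rw [← e] at this
        have := nonpos_of_mul_nonpos_left this hQ
        linarith
      · have : H x t = 0 := by rw [H_eq, qq_zero_of_lt x.2 t (by omega), mul_zero]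
        simp only [this, zero_div]
        exact div_nonneg (H_nonneg _ _) (by positivity)
    · have : H x t = 0 := by rw [H_eq, qq_zero_of_lt x.1 t (by omega), zero_mul]
      simp only [this, zero_div]
      exact div_nonneg (H_nonneg _ _) (by positivity)
  · rintro t ht ⟨h1, h2, h3⟩
    obtain ⟨Q, hQ, e⟩ := hcmp t ht h1 h2
    have := mul_nonneg (H_nonneg x t) h3
    rw [← e] at this
    have := nonneg_of_mul_nonneg_left this hQ
    linarith

lemma unimodal_zero (x : Vtx) (g : ℕ → ℝ) (hg : ∀ t : ℕ, 1 ≤ t → g t = 0) :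
    UnimodalOn g (Xdom x) :=
  unimodal_of x (fun _ => 0) (fun _ => True) 0
    ⟨(x.1 % 2).toNat + 2, ⟨by omega, by push_cast; omega⟩, trivial⟩ (by simp) (by simp) (by simp) g
    (fun t ht => by rw [hg t ht.1]; simp)

lemma gen1 (x : Vtx) (hx : inV x) (c : ℝ) (g : ℕ → ℝ) (hne : x.1 ≠ 0 ∨ x.2 ≠ 0)
    (hg : ∀ t : ℕ, 1 ≤ t → g t = c * (H x t / (t : ℝ))) :
    UnimodalOn g (Xdom x) := by
  apply gen x hx 1 c g _ _ (by simpa using hg)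
  · intro s hs
    rw [DD1]
    have : 0 ≤ s := by nlinarith [sq_nonneg (x.1 : ℝ), sq_nonneg (x.2 : ℝ)]
    have h : 0 ≤ s ^ 2 * (s - (5 + (x.1 : ℝ) ^ 2 + (x.2 : ℝ) ^ 2)) := mul_nonneg (sq_nonneg _) (by linarith)
    have h' : 0 ≤ (x.1 : ℝ) ^ 2 * (x.2 : ℝ) ^ 2 := by positivity
    have h'' : 0 ≤ s ^ 3 := by positivity
    apply mul_nonneg this
    nlinarith
  · intro s u h1 h2 hsu h0
    obtain ⟨m, hm1, hms, hm⟩ : ∃ m : ℤ, 1 ≤ m ∧ (m : ℝ) < s ∧ ((x.1 : ℝ) ^ 2 = (m : ℝ) ^ 2 ∨ (x.2 : ℝ) ^ 2 = (m : ℝ) ^ 2) := by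
      rcases hne with h | h
      · exact ⟨|x.1|, Int.one_le_abs h, h1, Or.inl (by push_cast; rw [sq_abs])⟩
      · exact ⟨|x.2|, Int.one_le_abs h, h2, Or.inr (by push_cast; rw [sq_abs])⟩
    have hm1' : (1 : ℝ) ≤ m := by exact_mod_cast hm1
    have hs : 0 < s := by linarith
    rw [DD1] at h0 ⊢
    have h0' := nonneg_of_mul_nonneg_right h0 hs
    apply mul_nonneg (by linarith)
    apply cubic_up 4 _ 2 _ m s u (by norm_num) (by positivity) (by linarith) hms hsu _ h0'
    have : (0 : ℝ) ≤ (m - 1) ^ 2 * (m - 2) := by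
      rcases hm1.eq_or_lt with h | h
      · rw [← h]; norm_num
      · have : (2 : ℝ) ≤ m := by exact_mod_cast h
        exact mul_nonneg (sq_nonneg _) (by linarith)
    have := mul_nonneg (show (0 : ℝ) ≤ m by linarith) this
    rcases hm with e | e <;> rw [e]
    · nlinarith
    · nlinarith

lemma gen2 (x : Vtx) (hx : inV x) (c : ℝ) (g : ℕ → ℝ) (hne1 : x.1 ≠ 0) (hne2 : x.2 ≠ 0)
    (hg : ∀ t : ℕ, 1 ≤ t → g t = c * (H x t / (t : ℝ) ^ 2)) :
    UnimodalOn g (Xdom x) := by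
  apply gen x hx 2 c g _ _ hg
  · intro s hs
    rw [DD2]
    have : 13 ≤ s := by nlinarith [sq_nonneg (x.1 : ℝ), sq_nonneg (x.2 : ℝ)]
    have h : 0 ≤ s ^ 2 * (s - (13 + (x.1 : ℝ) ^ 2 + (x.2 : ℝ) ^ 2)) := mul_nonneg (sq_nonneg _) (by linarith)
    have h' : 0 ≤ (x.1 : ℝ) ^ 2 * (x.2 : ℝ) ^ 2 := by positivity
    have h'' : 0 ≤ s ^ 3 := by positivity
    apply mul_nonneg (sq_nonneg _)
    nlinarith
  · intro s u h1 h2 hsu h0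
    have a1 : 1 ≤ |x.1| := Int.one_le_abs hne1
    have a2 : 1 ≤ |x.2| := Int.one_le_abs hne2
    have a1' : (1 : ℝ) ≤ ((|x.1| : ℤ) : ℝ) := by exact_mod_cast a1
    have hs : 0 < s := by linarith
    rw [DD2] at h0 ⊢
    apply mul_nonneg (sq_nonneg _)
    have e1 : (x.1 : ℝ) ^ 2 = ((|x.1| : ℤ) : ℝ) ^ 2 := by push_cast; rw [sq_abs]
    have e2 : (x.2 : ℝ) ^ 2 = ((|x.2| : ℤ) : ℝ) ^ 2 := by push_cast; rw [sq_abs]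
    by_cases hb : |x.1| = 1 ∧ |x.2| = 1
    · rw [e1, e2, hb.1, hb.2]
      have : 0 ≤ (u - 1) ^ 2 * (2 * u - 1) := mul_nonneg (sq_nonneg _) (by linarith)
      push_cast
      nlinarith
    · have h0' := nonneg_of_mul_nonneg_right h0 (by positivity)
      apply cubic_up 6 _ 12 _ ((|x.1| : ℤ) : ℝ) s u (by norm_num) _ (by linarith) h1 hsu _ h0'
      · rw [e1, e2]
        have : (2 : ℤ) ≤ |x.1| * |x.2| := by
          by_cases h : |x.1| = 1
          · have : 2 ≤ |x.2| := by omega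
            nlinarith
          · have : 2 ≤ |x.1| := by omega
            nlinarith
        have : (2 : ℝ) ≤ ((|x.1| : ℤ) : ℝ) * ((|x.2| : ℤ) : ℝ) := by exact_mod_cast this
        nlinarith
      · rw [e1]
        generalize (x.2 : ℝ) ^ 2 = Y
        generalize ((|x.1| : ℤ) : ℝ) = m
        nlinarith [sq_nonneg ((m - 1) * (m - 2))]

/-- For distinct directions `A ≠ A'`, the sum of the two influences
`t ↦ INF(x,A,t) + INF(x,A',t)` is unimodal on the positive integers
`t ≡ x₁ (mod 2)`. -/
theorem INF_pair_unimodal (x : Vtx) (hx : inV x) (A A' : Vtx)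
    (hA : A ∈ DIRset) (hA' : A' ∈ DIRset) (hne : A ≠ A') :
    UnimodalOn (fun t => INF x A t + INF x A' t) (Xdom x) := by
  have key : ∀ e1 e2 d1 d2 : ℤ, (e1 = 1 ∨ e1 = -1) → (e2 = 1 ∨ e2 = -1) →
      (d1 = 1 ∨ d1 = -1) → (d2 = 1 ∨ d2 = -1) → (e1, e2) ≠ (d1, d2) →
      UnimodalOn (fun t => INF x (e1, e2) t + INF x (d1, d2) t) (Xdom x) := by
    intro e1 e2 d1 d2 he1 he2 hd1 hd2 hne
    have hf : ∀ t : ℕ, 1 ≤ t → INF x (e1, e2) t + INF x (d1, d2) t =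
        H x t * ((1 - e1 * x.1 / t) * (1 - e2 * x.2 / t) - 1)
        + H x t * ((1 - d1 * x.1 / t) * (1 - d2 * x.2 / t) - 1) := by
      intro t ht
      rw [INF_eq x e1 e2 he1 he2 t ht, INF_eq x d1 d2 hd1 hd2 t ht]
    by_cases c1 : d1 = e1
    · have c2 : d2 = -e2 := by
        have : e2 ≠ d2 := fun h => hne (by rw [c1, h])
        omega
      subst c1 c2
      by_cases hz : x.1 = 0
      · apply unimodal_zero
        intro t ht
        simp only [hf t ht, hz]; push_cast; ring
      · apply gen1 x hx (-2 * d1 * x.1) _ (Or.inl hz)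
        intro t ht
        simp only [hf t ht]; push_cast; ring
    · have c1' : d1 = -e1 := by omega
      by_cases c2 : d2 = e2
      · subst c1' c2
        by_cases hz : x.2 = 0
        · apply unimodal_zero
          intro t ht
          simp only [hf t ht, hz]; push_cast; ring
        · apply gen1 x hx (-2 * d2 * x.2) _ (Or.inr hz)
          intro t ht
          simp only [hf t ht]; push_cast; ring
      · have c2' : d2 = -e2 := by omega
        subst c1' c2'
        by_cases hz : x.1 = 0
        · apply unimodal_zero
          intro t ht
          simp only [hf t ht, hz]; push_cast; ring
        by_cases hz2 : x.2 = 0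
        · apply unimodal_zero
          intro t ht
          simp only [hf t ht, hz2]; push_cast; ring
        apply gen2 x hx (2 * e1 * e2 * x.1 * x.2) _ hz hz2
        intro t ht
        simp only [hf t ht]; push_cast; ring
  have hD : ∀ B ∈ DIRset, (B.1 = 1 ∨ B.1 = -1) ∧ (B.2 = 1 ∨ B.2 = -1) := by
    intro B hB
    simp only [DIRset, Finset.mem_insert, Finset.mem_singleton] at hB
    rcases hB with rfl | rfl | rfl | rfl <;> simp
  exact key A.1 A.2 A'.1 A'.2 (hD A hA).1 (hD A hA).2 (hD A' hA').1 (hD A' hA').2 hne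
end
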